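/- arXiv:1412.7290 — 5 statements merged into one kernel-verified Lean document; each statement's English description precedes it below -/
import Mathlib

section
/- Let C be a code in H(m,q) with minimum distance δ and |C| ≥ 2, and let α, β ∈ C with d(α,β) = δ. Then for every a ∈ Q there exists an automorphism x of H(m,q) such that (i) α^x is the constant tuple (a,…,a), and (ii) for each γ ∈ Diff(α,β,C), γ^x = (c^δ, a^{m−δ}) for some c ∈ Q \ {a}, i.e. γ^x takes a single value c ≠ a on the first δ entries and the value a on the remaining m−δ entries. -/
open Equiv

namespace NT

/-- Vertices of the Hamming graph `H(m,q)`. -/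
abbrev V (m q : ℕ) := Fin m → Fin q

/-- The automorphism of `H(m,q)` determined by alphabet permutations `g` and
an entry permutation `σ`:  `α ↦ (i ↦ gᵢ (α (σ⁻¹ i)))`. -/
def hAut (m q : ℕ) (g : Fin m → Perm (Fin q)) (σ : Perm (Fin m)) :
    Perm (V m q) where
  toFun α := fun i => g i (α (σ⁻¹ i))
  invFun α := fun i => (g (σ i))⁻¹ (α (σ i))
  left_inv α := by funext i; simp
  right_inv α := by funext i; simp

/-- The automorphism group of the Hamming graph, as a subgroup of the group of
all permutations of the vertex set:  `S_q^m ⋊ S_m`. -/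
def HammingAut (m q : ℕ) : Subgroup (Perm (V m q)) where
  carrier := {x | ∃ g σ, x = hAut m q g σ}
  one_mem' := ⟨fun _ => 1, 1, by ext α i; simp [hAut]⟩
  mul_mem' := by
    rintro x y ⟨g, σ, rfl⟩ ⟨h, τ, rfl⟩
    exact ⟨fun i => g i * h (σ⁻¹ i), σ * τ, by ext α i; simp [hAut, Perm.mul_apply]⟩
  inv_mem' := by
    rintro x ⟨g, σ, rfl⟩
    refine ⟨fun i => (g (σ i))⁻¹, σ⁻¹, ?_⟩
    ext α i
    simp [hAut, Perm.inv_def]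

/-- The minimum distance of a code `C ⊆ H(m,q)`. -/
noncomputable def minDist (m q : ℕ) (C : Set (V m q)) : ℕ :=
  sInf {d | ∃ α ∈ C, ∃ β ∈ C, α ≠ β ∧ hammingDist α β = d}

/-- The distance `d(α, C)` from a vertex to a code. -/
noncomputable def distTo (m q : ℕ) (C : Set (V m q)) (α : V m q) : ℕ :=
  sInf {d | ∃ β ∈ C, hammingDist α β = d}

/-- `C_r`, the set of vertices at distance exactly `r` from the code `C`. -/
def cell (m q : ℕ) (C : Set (V m q)) (r : ℕ) : Set (V m q) :=
  {α | distTo m q C α = r}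

/-- The covering radius of a code. -/
noncomputable def covRad (m q : ℕ) (C : Set (V m q)) : ℕ :=
  sSup (Set.range (distTo m q C))

/-- `S` is an orbit of the subgroup `X ≤ Sym(V)`. -/
def IsOrbit (m q : ℕ) (X : Subgroup (Perm (V m q))) (S : Set (V m q)) : Prop :=
  S.Nonempty ∧ (∀ x ∈ X, ∀ ν ∈ S, x ν ∈ S) ∧
    ∀ ν ∈ S, ∀ μ ∈ S, ∃ x ∈ X, x ν = μ

/-- `C` is `(X,s)`-neighbour transitive:  `X` is a group of automorphisms of the
Hamming graph and each of `C, C_1, …, C_s` is an `X`-orbit. -/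
def IsNT (m q : ℕ) (X : Subgroup (Perm (V m q))) (C : Set (V m q)) (s : ℕ) : Prop :=
  X ≤ HammingAut m q ∧ IsOrbit m q X C ∧
    ∀ i, 1 ≤ i → i ≤ s → IsOrbit m q X (cell m q C i)

/-- `X` acts faithfully on the set of entries, i.e. `X ∩ S_q^m = 1`. -/
def EntryFaithful (m q : ℕ) (X : Subgroup (Perm (V m q))) : Prop :=
  ∀ x ∈ X, (∃ g, x = hAut m q g 1) → x = 1

/-- The image of `X` in `S_m` under the entry action `μ`. -/
def entryImage (m q : ℕ) (X : Subgroup (Perm (V m q))) : Set (Perm (Fin m)) :=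
  {σ | ∃ x ∈ X, ∃ g, x = hAut m q g σ}

/-- Two codes are equivalent if one is the image of the other under an
automorphism of the Hamming graph. -/
def CodeEquiv (m q : ℕ) (C C' : Set (V m q)) : Prop :=
  ∃ x ∈ HammingAut m q, x '' C = C'

/-- The repetition code: all constant tuples. -/
def RepCode (m q : ℕ) : Set (V m q) := {α | ∃ a, α = fun _ => a}

/-- The zero vertex. -/
def zeroV (m q : ℕ) [NeZero q] : V m q := fun _ => 0

/-- The weight of a vertex: the number of nonzero entries. -/
noncomputable def wt (m q : ℕ) [NeZero q] (α : V m q) : ℕ :=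
  hammingNorm α

/-- `α` covers `ν` if `α` agrees with `ν` on every nonzero entry of `ν`. -/
def Covers (m q : ℕ) [NeZero q] (α ν : V m q) : Prop :=
  ∀ i, ν i ≠ 0 → ν i = α i

/-- A `q`-ary `s-(m,k,λ)` design: a set of weight-`k` vertices such that every
weight-`s` vertex is covered by exactly `λ` of them. -/
noncomputable def IsDesign (m q : ℕ) [NeZero q] (s k lam : ℕ) (D : Set (V m q)) : Prop :=
  (∀ α ∈ D, wt m q α = k) ∧
    ∀ ν : V m q, wt m q ν = s → {α ∈ D | Covers m q α ν}.ncard = lam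

/-- `C` is `s`-regular: for each `i ≤ s` and `k ≤ m`, the number
`|Γ_k(ν) ∩ C|` is the same for all `ν ∈ C_i`. -/
def SRegular (m q : ℕ) (C : Set (V m q)) (s : ℕ) : Prop :=
  ∀ i ≤ s, ∀ k ≤ m, ∀ ν ∈ cell m q C i, ∀ μ ∈ cell m q C i,
    {β ∈ C | hammingDist ν β = k}.ncard = {β ∈ C | hammingDist μ β = k}.ncard

/-- The automorphism group of a code: the setwise stabiliser of `C` in the
automorphism group of the Hamming graph. -/
def AutCode (m q : ℕ) (C : Set (V m q)) : Subgroup (Perm (V m q)) where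
  carrier := {x | x ∈ HammingAut m q ∧ x '' C = C}
  one_mem' := ⟨(HammingAut m q).one_mem, by simp⟩
  mul_mem' := by
    rintro x y ⟨hx, hx'⟩ ⟨hy, hy'⟩
    exact ⟨mul_mem hx hy, by rw [Perm.coe_mul, Set.image_comp, hy', hx']⟩
  inv_mem' := by
    rintro x ⟨hx, hx'⟩
    refine ⟨inv_mem hx, ?_⟩
    conv_lhs => rw [← hx']
    rw [← Set.image_comp]
    simp [Perm.inv_def]

/-- `N` is a minimal normal subgroup of the (sub)group `H`. -/
def IsMinNormalIn {G : Type*} [Group G] (H N : Subgroup G) : Prop :=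
  N ≤ H ∧ N ≠ ⊥ ∧ (∀ h ∈ H, ∀ n ∈ N, h * n * h⁻¹ ∈ N) ∧
    ∀ K : Subgroup G, K ≤ H → K ≠ ⊥ →
      (∀ h ∈ H, ∀ k ∈ K, h * k * h⁻¹ ∈ K) → K ≤ N → K = N

/-- The socle of a subgroup `H`: the subgroup generated by all minimal
normal subgroups of `H`. -/
def socleIn {G : Type*} [Group G] (H : Subgroup G) : Subgroup G :=
  ⨆ N ∈ {N : Subgroup G | IsMinNormalIn H N}, N

/-- A row of the punctured Hadamard 12 code: the binary vector whose entry at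
`a ∈ F₁₁` is `1` exactly when `a - b` is a square in `F₁₁` (including `0`),
corresponding to the translate by `b` of the first row of the normalised Paley
Hadamard matrix of order 12 (with the `*` coordinate deleted, and with the
Hadamard entry `-1` encoded as `1`, `1` as `0`). -/
def hadRow (b : ZMod 11) : V 11 2 :=
  fun i => if ∃ c : ZMod 11, c ^ 2 = ((i : ℕ) : ZMod 11) - b then 1 else 0

/-- The punctured Hadamard code of length 12 in `H(11,2)`: the zero vector and
all-ones vector (from the all-`(-1)` row of `-H₁₂` and of `H₁₂`), the eleven
weight-6 rows `hadRow b`, and their complements (the rows of `-H₁₂`). -/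
def PHad : Set (V 11 2) :=
  {(fun _ => 0), (fun _ => 1)} ∪ Set.range hadRow ∪
    Set.range (fun b => (fun i => 1 - hadRow b i : V 11 2))

/-- The even weight subcode of the punctured Hadamard code of length 12: the
zero vector together with the eleven weight-6 codewords. -/
def ESub : Set (V 11 2) :=
  insert (fun _ => 0) (Set.range hadRow)

end NT

theorem exists_perm_apply_eq_of_injOn {X ι : Type*} [Finite ι] {S : Set X} {u v : X → ι}
    (hu : S.InjOn u) (hv : S.InjOn v) : ∃ h : Equiv.Perm ι, ∀ x ∈ S, h (u x) = v x := by
  classical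
  let e : {y // y ∈ u '' S} ≃ {y // y ∈ v '' S} :=
    (Equiv.Set.imageOfInjOn u S hu).symm.trans (Equiv.Set.imageOfInjOn v S hv)
  refine ⟨e.extendSubtype, fun x hx => ?_⟩
  rw [Equiv.extendSubtype_apply_of_mem e (u x) (Set.mem_image_of_mem u hx)]
  have hx' : (Equiv.Set.imageOfInjOn u S hu).symm ⟨u x, Set.mem_image_of_mem u hx⟩ = ⟨x, hx⟩ :=
    (Equiv.symm_apply_eq _).2 rfl
  change ((Equiv.Set.imageOfInjOn v S hv) ((Equiv.Set.imageOfInjOn u S hu).symm _) : ι) = v x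
  rw [hx']
  rfl

theorem exists_perm_mem_iff {ι : Type*} [Fintype ι] {p r : ι → Prop}
    [DecidablePred p] [DecidablePred r]
    (h : Fintype.card {i // p i} = Fintype.card {i // r i}) :
    ∃ σ : Equiv.Perm ι, ∀ i, r (σ i) ↔ p i := by
  let e := Fintype.equivOfCardEq h
  refine ⟨e.extendSubtype, fun i => ⟨fun hi => ?_, e.extendSubtype_mem i⟩⟩
  by_contra hp
  exact e.extendSubtype_not_mem i hp hi

theorem NT.minDist_le_hammingDist {m q : ℕ} {C : Set (NT.V m q)} {α β : NT.V m q}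
    (hα : α ∈ C) (hβ : β ∈ C) (h : α ≠ β) : NT.minDist m q C ≤ hammingDist α β :=
  Nat.sInf_le ⟨α, hα, β, hβ, h, rfl⟩

theorem NT.minDist_pos {m q : ℕ} {C : Set (NT.V m q)} (hC : C.Nontrivial) :
    0 < NT.minDist m q C := by
  obtain ⟨α, hα, β, hβ, h⟩ := hC
  obtain ⟨α', _, β', _, hne, hd⟩ :=
    Nat.sInf_mem (s := {d | ∃ α ∈ C, ∃ β ∈ C, α ≠ β ∧ hammingDist α β = d})
      ⟨_, α, hα, β, hβ, h, rfl⟩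
  change hammingDist α' β' = NT.minDist m q C at hd
  rw [← hd]
  exact hammingDist_pos.2 hne

/-- Distinct codewords agreeing outside the difference set of a pair of codewords at minimum
distance differ at every entry of that set. -/
theorem NT.apply_ne_of_agree_off {m q : ℕ} {C : Set (NT.V m q)} {α β γ ε : NT.V m q}
    (hd : hammingDist α β = NT.minDist m q C) (hγ : γ ∈ C) (hε : ε ∈ C) (hne : γ ≠ ε)
    (hoff : ∀ i, α i = β i → γ i = ε i) {i : Fin m} (hi : α i ≠ β i) : γ i ≠ ε i := by
  have hle := NT.minDist_le_hammingDist hγ hε hne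
  rw [← hd] at hle
  have hsub : Finset.filter (fun i => γ i ≠ ε i) Finset.univ ⊆
      Finset.filter (fun i => α i ≠ β i) Finset.univ := by
    intro j hj
    simp only [Finset.mem_filter_univ] at hj ⊢
    exact fun h => hj (hoff j h)
  have heq := Finset.eq_of_subset_of_card_le hsub hle
  have : i ∈ ({i | γ i ≠ ε i} : Finset (Fin m)) := by
    rw [heq]
    simpa using hi
  simpa using this

open NT Equiv in
/-- Lemma 2.2: there is an automorphism moving `α` to the constant
tuple `(a,…,a)` and every `γ ∈ Diff(α,β,C)` to a tuple `(c^δ, a^{m-δ})`. -/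
theorem stmt_1 (m q : ℕ) (hm : 2 ≤ m) (hq : 2 ≤ q) (C : Set (V m q)) (δ : ℕ)
    (hδ : minDist m q C = δ) (hC : 2 ≤ C.ncard)
    (α β : V m q) (hα : α ∈ C) (hβ : β ∈ C) (hd : hammingDist α β = δ) :
    ∀ a : Fin q, ∃ x ∈ HammingAut m q,
      (x α = fun _ => a) ∧
      ∀ γ ∈ C, {i | α i ≠ γ i} = {i | α i ≠ β i} →
        ∃ c : Fin q, c ≠ a ∧ x γ = fun i : Fin m => if (i : ℕ) < δ then c else a := by
  intro a
  subst hδ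
  have hpos : 0 < minDist m q C :=
    minDist_pos ((Set.one_lt_ncard_iff_nontrivial_and_finite.1 hC).1)
  obtain ⟨i₀, hi₀⟩ : ∃ i, α i ≠ β i :=
    Function.ne_iff.1 (hammingDist_pos.1 (hd ▸ hpos))
  let S : Set (V m q) := insert α {γ ∈ C | {i | α i ≠ γ i} = {i | α i ≠ β i}}
  have hSC : S ⊆ C := Set.insert_subset hα (Set.sep_subset _ _)
  have hSα : ∀ γ ∈ S, ∀ i, α i = β i → α i = γ i := by
    rintro γ (rfl | hγ) i hi
    · rfl
    · by_contra h
      exact (hγ.2 ▸ h : i ∈ {i | α i ≠ β i}) hi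
  have hinj : ∀ i, α i ≠ β i → S.InjOn (fun γ => γ i) := by
    intro i hi γ hγ ε hε h
    by_contra hne
    exact apply_ne_of_agree_off hd (hSC hγ) (hSC hε) hne
      (fun j hj => (hSα γ hγ j hj).symm.trans (hSα ε hε j hj)) hi h
  have hperm : ∀ i, ∃ h : Perm (Fin q), h (α i) = a ∧
      (α i ≠ β i → ∀ γ ∈ S, h (γ i) = swap (α i₀) a (γ i₀)) := by
    intro i
    by_cases hi : α i = β i
    · exact ⟨swap (α i) a, swap_apply_left _ _, fun h => absurd hi h⟩
    · obtain ⟨h, hh⟩ := exists_perm_apply_eq_of_injOn (hinj i hi)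
        ((swap (α i₀) a).injective.comp_injOn (hinj i₀ hi₀))
      exact ⟨h, (hh α (Set.mem_insert _ _)).trans (swap_apply_left _ _), fun _ => hh⟩
  choose h hhα hhS using hperm
  have hcard : Fintype.card {i : Fin m // α i ≠ β i} =
      Fintype.card {i : Fin m // (i : ℕ) < minDist m q C} := by
    have hle : minDist m q C ≤ m := by
      simpa [hd] using hammingDist_le_card_fintype (x := α) (y := β)
    rw [Fintype.card_subtype, Fintype.card_subtype, Fin.card_filter_val_lt, min_eq_right hle]
    exact hd
  obtain ⟨σ, hσ⟩ := exists_perm_mem_iff hcard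
  refine ⟨hAut m q (fun i => h (σ⁻¹ i)) σ, ⟨_, _, rfl⟩, funext fun i => hhα _, ?_⟩
  intro γ hγ hdiff
  have hγS : γ ∈ S := Set.mem_insert_of_mem _ ⟨hγ, hdiff⟩
  refine ⟨swap (α i₀) a (γ i₀), fun hc => ?_, funext fun i => ?_⟩
  · have hne : i₀ ∈ {i | α i ≠ γ i} := hdiff ▸ hi₀
    exact hne ((swap (α i₀) a).injective ((swap_apply_left _ _).trans hc.symm))
  · have hi := hσ (σ⁻¹ i)
    rw [← Perm.mul_apply, mul_inv_cancel, Perm.one_apply] at hi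
    change h (σ⁻¹ i) (γ (σ⁻¹ i)) = _
    split_ifs with hlt
    · exact hhS _ (hi.1 hlt) γ hγS
    · rw [← hSα γ hγS _ (not_not.1 (mt hi.2 hlt))]
      exact hhα _
end

section
/- Let C be a code in H(m,q) with minimum distance δ and |C| ≥ 2, and let α, β ∈ C with d(α,β) = δ. Then for each entry k ∈ Diff(α,β), the values α_k together with the values γ_k for γ ∈ Diff(α,β,C) are pairwise distinct elements of Q; consequently |Diff(α,β,C)| ≤ q − 1. -/
open Equiv

namespace NT

theorem minDist_le_hammingDist_s2 {m q : ℕ} {C : Set (V m q)} {γ γ' : V m q}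
    (hγ : γ ∈ C) (hγ' : γ' ∈ C) (hne : γ ≠ γ') : minDist m q C ≤ hammingDist γ γ' :=
  Nat.sInf_le ⟨γ, hγ, γ', hγ', hne, rfl⟩

theorem exists_ne_of_hammingDist_eq_minDist {m q : ℕ} {C : Set (V m q)} (hC : 2 ≤ C.ncard)
    {α β : V m q} (hd : hammingDist α β = minDist m q C) : ∃ k, α k ≠ β k := by
  obtain ⟨γ, hγ, γ', hγ', hne⟩ := (Set.one_lt_ncard (Set.toFinite C)).1 hC
  obtain ⟨a, -, b, -, hab, h⟩ : minDist m q C ∈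
      {d | ∃ α ∈ C, ∃ β ∈ C, α ≠ β ∧ hammingDist α β = d} :=
    Nat.sInf_mem ⟨_, γ, hγ, γ', hγ', hne, rfl⟩
  exact Function.ne_iff.1 (hammingDist_pos.1 (hd ▸ h ▸ hammingDist_pos.2 hab))

theorem hammingDist_lt_of_eq_off_diff {m q : ℕ} {α β γ γ' : V m q} {k : Fin m}
    (hk : α k ≠ β k) (h : ∀ i, α i = β i → γ i = γ' i) (hγk : γ k = γ' k) :
    hammingDist γ γ' < hammingDist α β := by
  refine Finset.card_lt_card (Finset.ssubset_iff_of_subset ?_ |>.2 ⟨k, ?_, ?_⟩)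
  · exact Finset.monotone_filter_right _ fun i _ hi hi' => hi (h i hi')
  · simpa using hk
  · simpa using hγk

end NT

open NT Equiv in
/-- for `k ∈ Diff(α,β)`, the values `α_k` and `γ_k` for
`γ ∈ Diff(α,β,C)` are pairwise distinct; hence `|Diff(α,β,C)| ≤ q - 1`. -/
theorem stmt_2 (m q : ℕ) (hm : 2 ≤ m) (hq : 2 ≤ q) (C : Set (V m q)) (δ : ℕ)
    (hδ : minDist m q C = δ) (hC : 2 ≤ C.ncard)
    (α β : V m q) (hα : α ∈ C) (hβ : β ∈ C) (hd : hammingDist α β = δ) :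
    (∀ k : Fin m, α k ≠ β k →
      (∀ γ ∈ C, {i | α i ≠ γ i} = {i | α i ≠ β i} → γ k ≠ α k) ∧
      Set.InjOn (fun γ : V m q => γ k)
        {γ ∈ C | {i | α i ≠ γ i} = {i | α i ≠ β i}}) ∧
    {γ ∈ C | {i | α i ≠ γ i} = {i | α i ≠ β i}}.ncard ≤ q - 1 := by
  subst hδ
  have hdiff : ∀ k : Fin m, α k ≠ β k →
      (∀ γ ∈ C, {i | α i ≠ γ i} = {i | α i ≠ β i} → γ k ≠ α k) ∧
      Set.InjOn (fun γ : V m q => γ k)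
        {γ ∈ C | {i | α i ≠ γ i} = {i | α i ≠ β i}} := by
    intro k hk
    refine ⟨fun γ _ h => Ne.symm ((Set.ext_iff.1 h k).2 hk), ?_⟩
    rintro γ ⟨hγ, h⟩ γ' ⟨hγ', h'⟩ hγk
    by_contra hne
    have hlt : hammingDist γ γ' < hammingDist α β := by
      refine hammingDist_lt_of_eq_off_diff hk (fun i hi => ?_) hγk
      have e : α i = γ i := not_not.1 fun hn => (Set.ext_iff.1 h i).1 hn hi
      have e' : α i = γ' i := not_not.1 fun hn => (Set.ext_iff.1 h' i).1 hn hi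
      exact e.symm.trans e'
    exact absurd (minDist_le_hammingDist_s2 hγ hγ' hne) (not_le.2 (hd ▸ hlt))
  refine ⟨hdiff, ?_⟩
  obtain ⟨k, hk⟩ := exists_ne_of_hammingDist_eq_minDist hC hd
  obtain ⟨hne, hinj⟩ := hdiff k hk
  calc _ ≤ ({α k}ᶜ : Set (Fin q)).ncard :=
        Set.ncard_le_ncard_of_injOn (fun γ : V m q => γ k)
          (fun γ hγ => hne γ hγ.1 hγ.2) hinj
    _ = q - 1 := by rw [Set.ncard_compl, Set.ncard_singleton, Nat.card_fin]
end

section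
/- Let C be an (X,s)-neighbour transitive code in H(m,q) with minimum distance δ. Then for every α ∈ C and every i with 1 ≤ i ≤ min{s, ⌊(δ−1)/2⌋}, the stabiliser X_α fixes the sphere Γ_i(α) setwise and acts transitively on Γ_i(α). In particular, X_α acts i-homogeneously on M, i.e. transitively on the set of i-subsets of M. -/
open Equiv

namespace NT

variable {m q : ℕ}

/-- Automorphisms of the Hamming graph carry the entries where two vertices differ along the
entry permutation. -/
lemma hAut_apply_ne_iff (g : Fin m → Equiv.Perm (Fin q)) (σ : Equiv.Perm (Fin m))
    (a b : V m q) (j : Fin m) :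
    hAut m q g σ a j ≠ hAut m q g σ b j ↔ a (σ⁻¹ j) ≠ b (σ⁻¹ j) :=
  (g j).injective.ne_iff

lemma hammingDist_apply_of_mem_hammingAut {x : Equiv.Perm (V m q)} (hx : x ∈ HammingAut m q)
    (a b : V m q) : hammingDist (x a) (x b) = hammingDist a b := by
  obtain ⟨g, σ, rfl⟩ := hx
  refine Finset.card_bij' (fun j _ => σ⁻¹ j) (fun j _ => σ j) ?_ ?_ ?_ ?_ <;>
    simp [hAut]

lemma minDist_le_hammingDist_s4 {C : Set (V m q)} {a b : V m q} (ha : a ∈ C) (hb : b ∈ C)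
    (hab : a ≠ b) : minDist m q C ≤ hammingDist a b :=
  Nat.sInf_le ⟨a, ha, b, hb, hab, rfl⟩

/-- Balls of radius less than half the minimum distance around codewords are disjoint. -/
lemma eq_of_hammingDist_add_lt_minDist {C : Set (V m q)} {a b ν : V m q} (ha : a ∈ C)
    (hb : b ∈ C) (h : hammingDist a ν + hammingDist ν b < minDist m q C) : a = b := by
  by_contra hab
  have := minDist_le_hammingDist_s4 ha hb hab
  have := hammingDist_triangle a ν b
  omega

/-- Within the packing radius, the sphere around a codeword lies in the corresponding cell of the
distance partition. -/
lemma mem_cell_of_hammingDist_eq {C : Set (V m q)} {a ν : V m q} {i : ℕ} (ha : a ∈ C)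
    (hν : hammingDist a ν = i) (hi : 2 * i < minDist m q C) : ν ∈ cell m q C i := by
  refine le_antisymm (Nat.sInf_le ⟨a, ha, by rw [hammingDist_comm, hν]⟩) ?_
  refine le_csInf ⟨_, a, ha, rfl⟩ ?_
  rintro _ ⟨b, hb, rfl⟩
  by_contra! h
  obtain rfl := eq_of_hammingDist_add_lt_minDist ha hb (ν := ν) (by omega)
  rw [hammingDist_comm] at h
  omega

/-- Every vertex has another vertex differing from it exactly in a prescribed set of entries. -/
lemma exists_forall_ne_iff_mem (hq : 2 ≤ q) (a : V m q) (I : Finset (Fin m)) :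
    ∃ ν : V m q, ∀ j, a j ≠ ν j ↔ j ∈ I := by
  have : Nontrivial (Fin q) := Fin.nontrivial_iff_two_le.mpr hq
  choose f hf using fun y : Fin q => exists_ne y
  refine ⟨fun j => if j ∈ I then f (a j) else a j, fun j => ?_⟩
  by_cases hj : j ∈ I <;> simp [hj, (hf (a j)).symm]

lemma hammingDist_eq_card {a ν : V m q} {I : Finset (Fin m)} (h : ∀ j, a j ≠ ν j ↔ j ∈ I) :
    hammingDist a ν = I.card := by
  simp [hammingDist, h]

end NT

open NT Equiv in
/-- Proposition 2.5: for `α ∈ C` and `1 ≤ i ≤ min{s, ⌊(δ-1)/2⌋}`,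
the stabiliser `X_α` fixes `Γ_i(α)` setwise, acts transitively on `Γ_i(α)`, and
acts `i`-homogeneously on the set of entries `M`. -/
theorem stmt_4 (m q : ℕ) (hm : 2 ≤ m) (hq : 2 ≤ q)
    (X : Subgroup (Perm (V m q))) (C : Set (V m q)) (s : ℕ)
    (hNT : IsNT m q X C s) (α : V m q) (hα : α ∈ C)
    (i : ℕ) (hi1 : 1 ≤ i) (his : i ≤ s) (hiδ : i ≤ (minDist m q C - 1) / 2) :
    (∀ x ∈ X ⊓ MulAction.stabilizer (Perm (V m q)) α,
       ∀ ν : V m q, hammingDist α ν = i → hammingDist α (x ν) = i) ∧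
    (∀ ν μ : V m q, hammingDist α ν = i → hammingDist α μ = i →
       ∃ x ∈ X ⊓ MulAction.stabilizer (Perm (V m q)) α, x ν = μ) ∧
    (∀ I J : Finset (Fin m), I.card = i → J.card = i →
       ∃ x ∈ X ⊓ MulAction.stabilizer (Perm (V m q)) α,
         ∃ g σ, x = hAut m q g σ ∧ I.image σ = J) := by
  have hi : 2 * i < minDist m q C := by omega
  obtain ⟨hX, ⟨-, hC, -⟩, hcell⟩ := hNT
  have htrans : ∀ ν μ : V m q, hammingDist α ν = i → hammingDist α μ = i →
      ∃ x ∈ X ⊓ MulAction.stabilizer (Perm (V m q)) α, x ν = μ := by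
    intro ν μ hν hμ
    obtain ⟨x, hx, rfl⟩ := (hcell i hi1 his).2.2 ν (mem_cell_of_hammingDist_eq hα hν hi) μ
      (mem_cell_of_hammingDist_eq hα hμ hi)
    refine ⟨x, ⟨hx, ?_⟩, rfl⟩
    have hdist := hammingDist_apply_of_mem_hammingAut (hX hx) ν α
    rw [hammingDist_comm ν α] at hdist
    exact (eq_of_hammingDist_add_lt_minDist hα (hC x hx α hα) (ν := x ν) (by omega)).symm
  refine ⟨?_, htrans, ?_⟩
  · rintro x ⟨hx, hxα : x α = α⟩ ν hν
    rw [← hν, ← hammingDist_apply_of_mem_hammingAut (hX hx) α ν, hxα]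
  · intro I J hI hJ
    obtain ⟨ν, hν⟩ := exists_forall_ne_iff_mem hq α I
    obtain ⟨μ, hμ⟩ := exists_forall_ne_iff_mem hq α J
    obtain ⟨x, hx, hxν⟩ := htrans ν μ ((hammingDist_eq_card hν).trans hI)
      ((hammingDist_eq_card hμ).trans hJ)
    have hxα : x α = α := hx.2
    obtain ⟨g, σ, rfl⟩ := hX hx.1
    refine ⟨_, hx, g, σ, rfl, ?_⟩
    ext j
    have key := hAut_apply_ne_iff g σ α ν j
    rw [hxα, hxν, hμ, hν] at key
    rw [key, Finset.mem_image]
    exact ⟨fun ⟨k, hk, hkj⟩ => by simpa [← hkj] using hk, fun h => ⟨_, h, by simp⟩⟩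
end

section
/- Let C be an (X,1)-neighbour transitive code in H(m,q) with minimum distance δ ≥ 3 and |C| > 1. Let X_1 be the stabiliser in X of the entry 1 ∈ M, and let X_1^Q ≤ S_q be the image of X_1 under the homomorphism φ_1 sending (h_1,…,h_m)σ to h_1. Then X_1^Q acts 2-transitively on Q. -/
open Equiv

namespace NT

variable {m q : ℕ} {C : Set (V m q)}

lemma hAut_apply (g : Fin m → Perm (Fin q)) (σ : Perm (Fin m)) (α : V m q) (i : Fin m) :
    hAut m q g σ α i = g i (α (σ⁻¹ i)) := rfl

lemma hammingDist_hAut (g : Fin m → Perm (Fin q)) (σ : Perm (Fin m)) (α β : V m q) :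
    hammingDist (hAut m q g σ α) (hAut m q g σ β) = hammingDist α β := by
  unfold hammingDist
  refine Finset.card_equiv σ⁻¹ fun i => ?_
  simp [hAut_apply]

lemma hammingDist_update_self (α : V m q) (i : Fin m) {b : Fin q} (hb : b ≠ α i) :
    hammingDist (Function.update α i b) α = 1 := by
  unfold hammingDist
  rw [Finset.card_eq_one]
  refine ⟨i, ?_⟩
  ext j
  by_cases h : j = i
  · subst h; simpa using hb
  · simp [h]

/-- Two codewords at distance less than the minimum distance coincide. -/
lemma eq_of_hammingDist_lt_minDist {α β : V m q} (hα : α ∈ C) (hβ : β ∈ C)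
    (h : hammingDist α β < minDist m q C) : α = β := by
  by_contra hne
  exact Nat.notMem_of_lt_sInf h ⟨α, hα, β, hβ, hne, rfl⟩

lemma mem_cell_one_of_hammingDist_eq_one (hδ : 3 ≤ minDist m q C) {α ν : V m q} (hα : α ∈ C)
    (h : hammingDist ν α = 1) : ν ∈ cell m q C 1 := by
  have hmem : 1 ∈ {d | ∃ β ∈ C, hammingDist ν β = d} := ⟨α, hα, h⟩
  refine le_antisymm (Nat.sInf_le hmem) (Nat.one_le_iff_ne_zero.mpr fun h0 => ?_)
  obtain ⟨β, hβ, hd⟩ := Nat.sInf_mem ⟨1, hmem⟩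
  have hνβ : ν = β := hammingDist_eq_zero.mp (hd.trans h0)
  subst hνβ
  have hνα := eq_of_hammingDist_lt_minDist hβ hα (by omega)
  simp [hνα] at h

/-- In a neighbour transitive code, `X` acts transitively on the triples consisting of a
codeword, an entry, and a symbol different from the symbol of the codeword in that entry. -/
lemma IsNT.exists_map_flag {X : Subgroup (Perm (V m q))} (hNT : IsNT m q X C 1)
    (hδ : 3 ≤ minDist m q C) {α β : V m q} (hα : α ∈ C) (hβ : β ∈ C) (i j : Fin m)
    {b d : Fin q} (hb : b ≠ α i) (hd : d ≠ β j) :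
    ∃ g σ, hAut m q g σ ∈ X ∧ hAut m q g σ α = β ∧ σ i = j ∧
      g j (α i) = β j ∧ g j b = d := by
  obtain ⟨hX, ⟨-, hpres, -⟩, hcells⟩ := hNT
  obtain ⟨-, -, htrans⟩ := hcells 1 le_rfl le_rfl
  have hνα := hammingDist_update_self α i hb
  have hμβ := hammingDist_update_self β j hd
  obtain ⟨x, hx, hxν⟩ := htrans _ (mem_cell_one_of_hammingDist_eq_one hδ hα hνα)
    _ (mem_cell_one_of_hammingDist_eq_one hδ hβ hμβ)
  obtain ⟨g, σ, rfl⟩ := hX hx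
  have hαβ : hAut m q g σ α = β := by
    refine eq_of_hammingDist_lt_minDist (hpres _ hx α hα) hβ ?_
    have h1 := hammingDist_hAut g σ (Function.update α i b) α
    rw [hxν, hνα] at h1
    have h2 := hammingDist_triangle_left (hAut m q g σ α) β (Function.update β j d)
    omega
  have hj (k : Fin m) : g k (α (σ⁻¹ k)) = β k := congrFun hαβ k
  have hν : g j (Function.update α i b (σ⁻¹ j)) = d := by
    simpa [hAut_apply] using congrFun hxν j
  have hσ : σ⁻¹ j = i := by
    by_contra hne
    rw [Function.update_of_ne hne, hj] at hν
    exact hd hν.symm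
  refine ⟨g, σ, hx, hαβ, ?_, ?_, ?_⟩
  · rw [← hσ]; simp
  · rw [← hσ]; exact hj j
  · simpa [hσ] using hν

/-- Every symbol occurs in every entry of some codeword. -/
lemma IsNT.exists_mem_apply_eq {X : Subgroup (Perm (V m q))} (hNT : IsNT m q X C 1)
    (hδ : 3 ≤ minDist m q C) (hC : C.Nontrivial) (j : Fin m) (v : Fin q) :
    ∃ α ∈ C, α j = v := by
  obtain ⟨α, hα, β, hβ, hne⟩ := hC
  obtain ⟨i, hi⟩ := Function.ne_iff.mp hne
  by_cases hv : v = α j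
  · exact ⟨α, hα, hv.symm⟩
  obtain ⟨g, σ, hx, -, hσ, -, hg⟩ := hNT.exists_map_flag hδ hα hα i j hi.symm hv
  refine ⟨_, hNT.2.1.2.1 _ hx β hβ, ?_⟩
  have hσ' : σ⁻¹ j = i := by rw [← hσ]; simp
  rw [hAut_apply, hσ', hg]

end NT

open NT Equiv in
/-- Proposition 2.7: if `C` is `(X,1)`-neighbour transitive with
`δ ≥ 3` and `|C| > 1`, then `X₁^Q` (the image of the stabiliser of the first entry
under `φ₁`) acts 2-transitively on `Q`. -/
theorem stmt_6 (m q : ℕ) [NeZero m] (hm : 2 ≤ m) (hq : 2 ≤ q)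
    (X : Subgroup (Perm (V m q))) (C : Set (V m q))
    (hδ : 3 ≤ minDist m q C) (hC : 1 < C.ncard)
    (hNT : IsNT m q X C 1) :
    ∀ a b c d : Fin q, a ≠ b → c ≠ d →
      ∃ x ∈ X, ∃ g σ, x = hAut m q g σ ∧ σ (0 : Fin m) = 0 ∧
        g (0 : Fin m) a = c ∧ g (0 : Fin m) b = d := by
  intro a b c d hab hcd
  have hC' : C.Nontrivial := Set.one_lt_ncard_iff_nontrivial.mp hC
  obtain ⟨α, hα, rfl⟩ := hNT.exists_mem_apply_eq hδ hC' 0 a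
  obtain ⟨β, hβ, rfl⟩ := hNT.exists_mem_apply_eq hδ hC' 0 c
  obtain ⟨g, σ, hx, -, hσ, hg, hg'⟩ := hNT.exists_map_flag hδ hα hβ 0 0 hab.symm hcd.symm
  exact ⟨_, hx, g, σ, rfl, hσ, hg, hg'⟩
end

section
/- Let C be an s-regular code in H(m,q) with the zero vertex 0 ∈ C and minimum distance δ ≥ 2s. Then for each k with 0 ≤ k ≤ m, the set of codewords of C of weight k forms a q-ary s-(m, k, λ) design for some nonnegative integer λ (the empty design, with λ = 0, is allowed). -/
open Equiv

namespace NT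

open Polynomial

theorem covers_update {m q : ℕ} [NeZero q] {β ν : V m q} {i : Fin m} {a : Fin q}
    (hν : ν i = 0) (ha : a ≠ 0) :
    Covers m q β (Function.update ν i a) ↔ Covers m q β ν ∧ β i = a := by
  constructor
  · refine fun h => ⟨fun j hj => ?_, ?_⟩
    · have hji : j ≠ i := fun e => hj (e ▸ hν)
      simpa [Function.update_of_ne hji, hj] using h j
    · simpa [ha, eq_comm] using h i
  · rintro ⟨h, hi⟩ j hj
    by_cases hji : j = i
    · subst hji; simp [hi]
    · rw [Function.update_of_ne hji] at hj ⊢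
      exact h j hj

theorem wt_update {m q : ℕ} [NeZero q] {ν : V m q} {i : Fin m} {a : Fin q}
    (hν : ν i = 0) (ha : a ≠ 0) :
    wt m q (Function.update ν i a) = wt m q ν + 1 := by
  have h : ({j | Function.update ν i a j ≠ 0} : Finset (Fin m)) =
      insert i ({j | ν j ≠ 0} : Finset (Fin m)) := by
    ext j
    by_cases hji : j = i
    · subst hji; simp [ha]
    · simp [hji]
  simp only [wt, hammingNorm]
  rw [h, Finset.card_insert_of_notMem (by simp [hν])]

/-- The contribution of an entry to `wt α + wt ν - d(α, ν)`. -/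
def agreement {q : ℕ} [NeZero q] (a r : Fin q) : ℕ :=
  if a = 0 then 0 else if a = r then 2 else 1

theorem sum_agreement {m q : ℕ} [NeZero q] (β ν : V m q) :
    ∑ i with ν i ≠ 0, agreement (β i) (ν i) + hammingDist ν β = wt m q β + wt m q ν := by
  simp only [wt, hammingNorm, hammingDist, Finset.card_filter, Finset.sum_filter,
    ← Finset.sum_add_distrib]
  refine Finset.sum_congr rfl fun i _ => ?_
  unfold agreement
  by_cases h₁ : β i = 0 <;> by_cases h₂ : ν i = 0 <;> by_cases h₃ : β i = ν i <;>
    simp_all [eq_comm]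

open Classical in
/-- The enumerator, by agreement with `ρ` on `R`, of the elements of `D` covering `ν`. -/
noncomputable def coverEnum {m q : ℕ} [NeZero q] (D : Finset (V m q)) (ν ρ : V m q)
    (R : Finset (Fin m)) : ℤ[X] :=
  ∑ β ∈ D, if Covers m q β ν then ∏ i ∈ R, X ^ agreement (β i) (ρ i) else 0

theorem coverEnum_insert {m q : ℕ} [NeZero q] (D : Finset (V m q)) {ν ρ : V m q}
    {R : Finset (Fin m)} {i : Fin m} (hi : i ∉ R) (hν : ν i = 0) (hρ : ρ i ≠ 0) :
    coverEnum D ν ρ (insert i R) = coverEnum D ν ρ R +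
      (X ^ 2 - 1) * coverEnum D (Function.update ν i (ρ i)) ρ R +
      (X - 1) * ∑ a ∈ (Finset.univ.erase 0).erase (ρ i),
        coverEnum D (Function.update ν i a) ρ R := by
  classical
  simp only [coverEnum]
  rw [Finset.sum_comm, Finset.mul_sum, Finset.mul_sum, ← Finset.sum_add_distrib,
    ← Finset.sum_add_distrib]
  refine Finset.sum_congr rfl fun β _ => ?_
  have hsum : ∀ p : ℤ[X], (∑ a ∈ (Finset.univ.erase 0).erase (ρ i),
      if Covers m q β (Function.update ν i a) then p else 0) =
      if Covers m q β ν ∧ β i ≠ 0 ∧ β i ≠ ρ i then p else 0 := by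
    intro p
    have : ∀ a ∈ (Finset.univ.erase (0 : Fin q)).erase (ρ i),
        (if Covers m q β (Function.update ν i a) then p else 0) =
        if β i = a then (if Covers m q β ν then p else 0) else 0 := by
      intro a ha
      rw [covers_update hν (by simp_all)]
      by_cases h₁ : Covers m q β ν <;> by_cases h₂ : β i = a <;> simp [h₁, h₂]
    rw [Finset.sum_congr rfl this, Finset.sum_ite_eq]
    by_cases h₁ : Covers m q β ν <;> simp [h₁, and_comm]
  rw [hsum, Finset.prod_insert hi, covers_update hν hρ]
  by_cases h₁ : Covers m q β ν
  · by_cases h₂ : β i = 0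
    · simp [h₁, h₂, agreement, hρ.symm]
    · by_cases h₃ : β i = ρ i
      · simp [h₁, h₃, agreement, hρ]; ring
      · simp [h₁, h₂, h₃, agreement]; ring
  · simp [h₁]

open Classical in
/-- If the number of elements of `D` covering `ν` depends only on `wt ν` when `wt ν ≤ s`, then so
does the enumerator of `D` by agreement. -/
theorem exists_coverEnum_eq {m q s : ℕ} [NeZero q] (D : Finset (V m q))
    {l : ℕ → ℕ} (hl : ∀ ν, wt m q ν ≤ s → (D.filter (Covers m q · ν)).card = l (wt m q ν))
    (r : ℕ) :
    ∃ g : ℕ → ℤ[X], ∀ (ν ρ : V m q) (R : Finset (Fin m)), R.card = r →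
      wt m q ν + r ≤ s → (∀ i ∈ R, ν i = 0) → (∀ i ∈ R, ρ i ≠ 0) →
      coverEnum D ν ρ R = g (wt m q ν) := by
  induction r with
  | zero =>
    refine ⟨fun t => (l t : ℤ[X]), fun ν ρ R hR hs _ _ => ?_⟩
    rw [Finset.card_eq_zero] at hR
    simp [hR, coverEnum, ← hl ν hs]
  | succ r ih =>
    obtain ⟨g, hg⟩ := ih
    refine ⟨fun t => g t + (X ^ 2 - 1) * g (t + 1) + (X - 1) * (((q - 1 - 1 : ℕ) : ℤ[X]) * g (t + 1)),
      fun ν ρ R hR hs hν hρ => ?_⟩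
    obtain ⟨i, R, hi, rfl, hcard⟩ := Finset.card_eq_succ.mp hR
    have hνi := hν i (by simp)
    have hρi := hρ i (by simp)
    have hupd : ∀ a ≠ 0, coverEnum D (Function.update ν i a) ρ R = g (wt m q ν + 1) := by
      intro a ha
      rw [hg _ ρ R hcard (by rw [wt_update hνi ha]; omega) (fun j hj => ?_)
        (fun j hj => hρ j (by simp [hj])), wt_update hνi ha]
      rw [Function.update_of_ne (by rintro rfl; exact hi hj)]
      exact hν j (by simp [hj])
    rw [coverEnum_insert D hi hνi hρi, hupd _ hρi,
      hg ν ρ R hcard (by omega) (fun j hj => hν j (by simp [hj])) (fun j hj => hρ j (by simp [hj])),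
      Finset.sum_congr rfl fun a ha => hupd a (by simp_all)]
    rw [Finset.sum_const, Finset.card_erase_of_mem (by simp [hρi]), Finset.card_erase_of_mem
      (by simp), Finset.card_univ, Fintype.card_fin, nsmul_eq_mul]

open Classical in
theorem card_hammingDist_eq_of_covers {m q s w : ℕ} [NeZero q] (D : Finset (V m q))
    (hw : ∀ β ∈ D, wt m q β = w)
    {l : ℕ → ℕ} (hl : ∀ ν, wt m q ν ≤ s → (D.filter (Covers m q · ν)).card = l (wt m q ν))
    {ν μ : V m q} (hν : wt m q ν ≤ s) (h : wt m q ν = wt m q μ) (j : ℕ) :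
    (D.filter (hammingDist ν · = j)).card = (D.filter (hammingDist μ · = j)).card := by
  obtain ⟨g, hg⟩ := exists_coverEnum_eq D hl (wt m q ν)
  have hz : wt m q (0 : V m q) = 0 := hammingNorm_zero
  have key : ∀ η : V m q, wt m q η = wt m q ν →
      ((D.filter (hammingDist η · = j)).card : ℤ) =
        if j ≤ w + wt m q ν then (g 0).coeff (w + wt m q ν - j) else 0 := by
    intro η hη
    have hagr : ∀ β ∈ D,
        ∑ i with η i ≠ 0, agreement (β i) (η i) + hammingDist η β = w + wt m q ν := by
      intro β hβ
      rw [sum_agreement, hw β hβ, hη]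
    rw [← hz, ← hg 0 η {i | η i ≠ 0} hη (by omega) (by simp) (by simp)]
    have hcov : ∀ β : V m q, Covers m q β 0 := fun β i hi => absurd rfl hi
    simp only [coverEnum, hcov, if_true, Finset.prod_pow_eq_pow_sum, finsetSum_coeff, coeff_X_pow]
    rw [Finset.card_filter]
    push_cast
    split_ifs with hj
    · refine Finset.sum_congr rfl fun β hβ => ?_
      have := hagr β hβ
      congr 1
      simp only [eq_iff_iff]
      omega
    · refine Finset.sum_eq_zero fun β hβ => ?_
      have := hagr β hβ
      rw [if_neg (by omega)]
  exact_mod_cast (key ν rfl).trans (key μ h.symm).symm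

theorem hammingDist_add_wt_eq_iff_covers {m q : ℕ} [NeZero q] (β ν : V m q) :
    hammingDist ν β + wt m q ν = wt m q β ↔ Covers m q β ν := by
  have h := sum_agreement β ν
  have hle : ∀ i ∈ ({i | ν i ≠ 0} : Finset (Fin m)), agreement (β i) (ν i) ≤ 2 := by
    intro i _; unfold agreement; split_ifs <;> simp
  have hc : ∑ i with ν i ≠ 0, 2 = wt m q ν * 2 := by simp [wt, hammingNorm]
  have hiff := Finset.sum_eq_sum_iff_of_le hle
  have : Covers m q β ν ↔
      ∀ i ∈ ({i | ν i ≠ 0} : Finset (Fin m)), agreement (β i) (ν i) = 2 := by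
    simp only [Covers, Finset.mem_filter, Finset.mem_univ, true_and]
    refine forall₂_congr fun i hi => ?_
    unfold agreement
    split_ifs <;> simp_all [eq_comm]
  rw [this, ← hiff, hc]
  omega

theorem wt_le_hammingDist_add_wt {m q : ℕ} [NeZero q] (β ν : V m q) :
    wt m q β ≤ hammingDist ν β + wt m q ν := by
  have := hammingDist_triangle β ν 0
  rw [hammingDist_zero_right, hammingDist_zero_right, hammingDist_comm] at this
  exact this

theorem distTo_eq_wt {m q s : ℕ} [NeZero q] {C : Set (V m q)} (h0 : zeroV m q ∈ C)
    (hδ : 2 * s ≤ minDist m q C) {ν : V m q} (hν : wt m q ν ≤ s) :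
    distTo m q C ν = wt m q ν := by
  have hmem : wt m q ν ∈ {d | ∃ β ∈ C, hammingDist ν β = d} :=
    ⟨_, h0, hammingDist_zero_right ν⟩
  refine le_antisymm (Nat.sInf_le hmem) (le_csInf ⟨_, hmem⟩ ?_)
  rintro _ ⟨β, hβ, rfl⟩
  by_cases hβ0 : β = zeroV m q
  · subst hβ0
    exact (hammingDist_zero_right ν).ge
  · have hmin : minDist m q C ≤ wt m q β :=
      Nat.sInf_le ⟨β, hβ, _, h0, hβ0, hammingDist_zero_right β⟩
    have := wt_le_hammingDist_add_wt β ν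
    omega

open Classical in
theorem exists_card_covers_eq {m q s : ℕ} [NeZero q] {C : Set (V m q)} (h0 : zeroV m q ∈ C)
    (hreg : SRegular m q C s) (hδ : 2 * s ≤ minDist m q C) (k : ℕ) :
    ∃ l : ℕ → ℕ, ∀ ν, wt m q ν ≤ s →
      (({β | β ∈ C ∧ wt m q β = k} : Finset (V m q)).filter (Covers m q · ν)).card =
        l (wt m q ν) := by
  induction k using Nat.strong_induction_on with
  | _ k ih =>
  suffices H : ∀ ν μ : V m q, wt m q ν ≤ s → wt m q ν = wt m q μ →
      (({β | β ∈ C ∧ wt m q β = k} : Finset (V m q)).filter (Covers m q · ν)).card =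
      (({β | β ∈ C ∧ wt m q β = k} : Finset (V m q)).filter (Covers m q · μ)).card by
    refine ⟨fun t => if h : ∃ μ : V m q, wt m q μ = t then
      (({β | β ∈ C ∧ wt m q β = k} : Finset (V m q)).filter (Covers m q · h.choose)).card else 0,
      fun ν hν => ?_⟩
    have h : ∃ μ : V m q, wt m q μ = wt m q ν := ⟨ν, rfl⟩
    refine Eq.trans ?_ (dif_pos h).symm
    exact H ν _ hν h.choose_spec.symm
  intro ν μ hν hμ
  by_cases hk : wt m q ν ≤ k ∧ k - wt m q ν ≤ m
  · obtain ⟨hk, hkm⟩ := hk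
    have hcount : ∀ η : V m q, wt m q η = wt m q ν →
        {β ∈ C | hammingDist η β = k - wt m q ν}.ncard =
        ∑ w ∈ Finset.range k, (({β | β ∈ C ∧ wt m q β = w} : Finset (V m q)).filter
          (hammingDist η · = k - wt m q ν)).card +
        (({β | β ∈ C ∧ wt m q β = k} : Finset (V m q)).filter (Covers m q · η)).card := by
      intro η hη
      have hlast : ({β | β ∈ C ∧ wt m q β = k} : Finset (V m q)).filter (Covers m q · η) =
          ({β | β ∈ C ∧ wt m q β = k} : Finset (V m q)).filter
            (hammingDist η · = k - wt m q ν) := by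
        refine Finset.filter_congr fun β hβ => ?_
        have hβk : wt m q β = k := by simp_all
        rw [← hammingDist_add_wt_eq_iff_covers]
        omega
      rw [hlast, ← Finset.sum_range_succ (fun w =>
        (({β | β ∈ C ∧ wt m q β = w} : Finset (V m q)).filter
          (hammingDist η · = k - wt m q ν)).card),
        Set.ncard_eq_toFinset_card', Finset.card_eq_sum_card_fiberwise (f := wt m q)
          (t := Finset.range (k + 1))]
      · refine Finset.sum_congr rfl fun w _ => ?_
        congr 1
        ext β
        simp [and_right_comm]
      · intro β hβ
        have hβ' : hammingDist η β = k - wt m q ν := by simp_all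
        have := wt_le_hammingDist_add_wt β η
        simp only [Finset.coe_range, Set.mem_Iio]
        omega
    have hcells := hreg _ hν _ hkm ν (distTo_eq_wt h0 hδ hν) μ
      ((distTo_eq_wt h0 hδ (hμ ▸ hν)).trans hμ.symm)
    rw [hcount ν rfl, hcount μ hμ.symm] at hcells
    refine Nat.add_left_cancel (hcells.trans ?_)
    congr 1
    refine Finset.sum_congr rfl fun w hw => ?_
    obtain ⟨l, hl⟩ := ih w (Finset.mem_range.mp hw)
    exact (card_hammingDist_eq_of_covers (w := w) _ (by simp) hl hν hμ _).symm
  · have hempty : ∀ η : V m q, wt m q η = wt m q ν →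
        ({β | β ∈ C ∧ wt m q β = k} : Finset (V m q)).filter (Covers m q · η) = ∅ := by
      intro η hη
      refine Finset.filter_eq_empty_iff.mpr fun β hβ hcov => hk ?_
      have hβk : wt m q β = k := by simp_all
      have h₁ := (hammingDist_add_wt_eq_iff_covers β η).mpr hcov
      have h₂ : hammingDist η β ≤ m := by
        simpa using hammingDist_le_card_fintype (x := η) (y := β)
      omega
    rw [hempty ν rfl, hempty μ hμ.symm]

end NT

open NT Equiv in
/-- Theorem 2.13: if `C` is `s`-regular with `0 ∈ C` and `δ ≥ 2s`,
then for each `k ≤ m` the codewords of weight `k` form a `q`-ary `s-(m,k,λ)`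
design for some `λ ≥ 0`. -/
theorem stmt_9 (m q : ℕ) [NeZero q] (hm : 2 ≤ m) (hq : 2 ≤ q)
    (C : Set (V m q)) (s : ℕ) (h0 : zeroV m q ∈ C)
    (hreg : SRegular m q C s) (hδ : 2 * s ≤ minDist m q C) :
    ∀ k ≤ m, ∃ lam : ℕ, IsDesign m q s k lam {β ∈ C | wt m q β = k} := by
  classical
  intro k _
  obtain ⟨l, hl⟩ := exists_card_covers_eq h0 hreg hδ k
  refine ⟨l s, fun α hα => hα.2, fun ν hν => ?_⟩
  rw [← hν, ← hl ν hν.le, Set.ncard_eq_toFinset_card']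
  congr 1
  ext β
  simp
end
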